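/- Let Δ be a matroid on [s] of dimension s−1−c, let n ≥ c, and let f_1,…,f_s ∈ R = k[x_0,…,x_n] be homogeneous polynomials such that every subset of at most c+1 of them is an R-regular sequence. For positive integers m and r: (1) if I_Δ^{(m)} ⊆ I_Δ^r then φ_*(I_Δ)^{(m)} ⊆ φ_*(I_Δ)^r; (2) if moreover f_1,…,f_s is an R-regular sequence, then I_Δ^{(m)} ⊆ I_Δ^r if and only if φ_*(I_Δ)^{(m)} ⊆ φ_*(I_Δ)^r. -/

import Mathlib

/- ------------------------------------------------------------------
   Common definitions
------------------------------------------------------------------ -/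

open MvPolynomial CategoryTheory

noncomputable section

/-- The height of an ideal: the infimum of the heights of the prime ideals containing it. -/
noncomputable def idealHeight {A : Type*} [CommRing A] (I : Ideal A) : ℕ∞ :=
  ⨅ P ∈ {P : PrimeSpectrum A | I ≤ P.asIdeal}, Order.height P

/-- The depth of a module `M` with respect to an ideal `J`: the supremum of the lengths of
`M`-regular sequences consisting of elements of `J`. -/
noncomputable def idealDepth {A : Type*} [CommRing A] (J : Ideal A)
    (M : Type*) [AddCommGroup M] [Module A M] : ℕ∞ :=
  sSup {n : ℕ∞ | ∃ rs : List A, (rs.length : ℕ∞) = n ∧ (∀ r ∈ rs, r ∈ J) ∧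
    RingTheory.Sequence.IsRegular M rs}

/-- The irrelevant maximal ideal `(x_i : i ∈ σ)` of the polynomial ring `k[x_i : i ∈ σ]`. -/
def irrelevantIdeal (k : Type) [Field k] (σ : Type) : Ideal (MvPolynomial σ k) :=
  Ideal.span (Set.range (X : σ → MvPolynomial σ k))

/-- The quotient of a polynomial ring by an ideal `I` is Cohen–Macaulay if its depth with
respect to the irrelevant maximal ideal equals its Krull dimension. -/
def IsCMQuotient {k : Type} [Field k] {σ : Type} (I : Ideal (MvPolynomial σ k)) : Prop :=
  (idealDepth (irrelevantIdeal k σ) (MvPolynomial σ k ⧸ I) : WithBot ℕ∞)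
    = ringKrullDim (MvPolynomial σ k ⧸ I)

/-- An ideal of a polynomial ring is homogeneous if it contains all homogeneous components
of each of its elements. -/
def IsHomogeneousIdeal {k : Type} [Field k] {σ : Type} (I : Ideal (MvPolynomial σ k)) : Prop :=
  ∀ p ∈ I, ∀ i : ℕ, homogeneousComponent i p ∈ I

/-- The Hilbert function of `R/I`, `t ↦ dim_k [R/I]_t`, as a function `ℤ → ℤ`
(equal to `0` in negative degrees). -/
noncomputable def hilbertFn (k : Type) [Field k] {σ : Type} (I : Ideal (MvPolynomial σ k))
    (t : ℤ) : ℤ :=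
  if t < 0 then 0
  else
    (Module.finrank k (homogeneousSubmodule σ k t.toNat) : ℤ) -
    (Module.finrank k
      ((Submodule.restrictScalars k (I : Submodule (MvPolynomial σ k) (MvPolynomial σ k))) ⊓
        homogeneousSubmodule σ k t.toNat : Submodule k (MvPolynomial σ k)) : ℤ)

/-- `P` is the Hilbert polynomial of `R/I` if it agrees with the Hilbert function of `R/I`
in all sufficiently large degrees. -/
def IsHilbertPolyOf (k : Type) [Field k] {σ : Type} (I : Ideal (MvPolynomial σ k))
    (P : Polynomial ℚ) : Prop :=
  ∃ N : ℤ, ∀ t : ℤ, N ≤ t → (hilbertFn k I t : ℚ) = P.eval (t : ℚ)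

open Classical in
/-- The Hilbert polynomial of `R/I` (defined as `0` if none exists). -/
noncomputable def hilbertPoly (k : Type) [Field k] {σ : Type} (I : Ideal (MvPolynomial σ k)) :
    Polynomial ℚ :=
  if h : ∃ P : Polynomial ℚ, IsHilbertPolyOf k I P then h.choose else 0

/-- The multiplicity (degree) `e(R/I)`: `(δ-1)!` times the leading coefficient of the Hilbert
polynomial of `R/I`, whose degree is `δ - 1` where `δ = dim R/I ≥ 1`. -/
noncomputable def multiplicityDeg (k : Type) [Field k] {σ : Type}
    (I : Ideal (MvPolynomial σ k)) : ℚ :=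
  (Nat.factorial (hilbertPoly k I).natDegree) * (hilbertPoly k I).leadingCoeff

/-- The `m`-th symbolic power of an ideal `J`:
`J^{(m)} = ⋂_{P ∈ Ass(A/J)} (J^m A_P ∩ A)`. -/
noncomputable def symbolicPower {A : Type*} [CommRing A] (J : Ideal A) (m : ℕ) : Ideal A :=
  sInf { K : Ideal A | ∃ (P : Ideal A) (hP : IsAssociatedPrime P (A ⧸ J)),
    K = Ideal.comap (algebraMap A (Localization (@Ideal.primeCompl A _ P hP.1)))
          (Ideal.map (algebraMap A (Localization (@Ideal.primeCompl A _ P hP.1))) (J ^ m)) }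

/-- `α(I)`: the least degree of a nonzero form in `I`. -/
noncomputable def alphaDeg (k : Type) [Field k] {σ : Type} (I : Ideal (MvPolynomial σ k)) : ℕ :=
  sInf {d : ℕ | ∃ p ∈ I, p ≠ 0 ∧ MvPolynomial.IsHomogeneous p d}

/-- `dim_k Tor_i^A(M, N)`, the rank over the base field `k` of the Tor module. -/
noncomputable def torRank (k : Type) [Field k] (A : Type) [CommRing A] [Algebra k A]
    (M N : Type) [AddCommGroup M] [Module A M] [AddCommGroup N] [Module A N] (i : ℕ) :
    Cardinal :=
  Module.rank k (RestrictScalars k A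
    (((Tor (ModuleCat A) i).obj (ModuleCat.of A M)).obj (ModuleCat.of A N)))

/-- The `i`-th total Betti number `dim_k Tor_i(S/I, k)` of `S/I`, where
`k = S/(x_i : i ∈ σ)`. -/
noncomputable def bettiNum (k : Type) [Field k] {σ : Type} (I : Ideal (MvPolynomial σ k))
    (i : ℕ) : Cardinal :=
  torRank k (MvPolynomial σ k) (MvPolynomial σ k ⧸ I)
    (MvPolynomial σ k ⧸ irrelevantIdeal k σ) i

/-- The first map `I_S → I_C ⊕ I_S`, `g ↦ (g, f·g)`, of the basic double linkage sequence. -/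
def bdlFirstMap {A : Type*} [CommRing A] {I_S I_C : Ideal A} (h : I_S ≤ I_C) (f : A) :
    I_S →ₗ[A] I_C × I_S :=
  LinearMap.prod (Submodule.inclusion h) (f • LinearMap.id)

/-- The second map `I_C ⊕ I_S → f·I_C + I_S`, `(a, b) ↦ f·a - b`, of the basic double
linkage sequence. -/
def bdlSecondMap {A : Type*} [CommRing A] (I_C I_S : Ideal A) (f : A) :
    I_C × I_S →ₗ[A] ↥(Ideal.span {f} * I_C + I_S) :=
  LinearMap.coprod
    (LinearMap.codRestrict ((Ideal.span {f} * I_C + I_S : Ideal A) : Submodule A A)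
      (f • (Submodule.subtype (I_C : Submodule A A)))
      (fun c => Submodule.mem_sup_left
        (Ideal.mul_mem_mul (Ideal.mem_span_singleton_self f) c.2)))
    (- LinearMap.codRestrict ((Ideal.span {f} * I_C + I_S : Ideal A) : Submodule A A)
      (Submodule.subtype (I_S : Submodule A A))
      (fun c => Submodule.mem_sup_right c.2))

/-- The ideal `I_{V_{λ,c}}` of the codimension-`c` configuration determined by `f_1, …, f_s`:
the intersection of the ideals `(f_{i_1}, …, f_{i_c})` over all `c`-subsets. -/
def configIdeal {A : Type*} [CommRing A] {s : ℕ} (c : ℕ) (f : Fin s → A) : Ideal A :=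
  ⨅ T ∈ {T : Finset (Fin s) | T.card = c}, Ideal.span (f '' ↑T)

/-- Every sublist of at most `m` of the elements `f 1, …, f s` (in any order, without
repetitions) is a regular sequence. -/
def SubsetsRegular {A : Type*} [CommRing A] {s : ℕ} (f : Fin s → A) (m : ℕ) : Prop :=
  ∀ l : List (Fin s), l.Nodup → l.length ≤ m →
    RingTheory.Sequence.IsRegular A (l.map f)

/-- `Δ` is (the independence complex of) a matroid on `{1, …, s}`: a nonempty collection of
subsets closed under inclusion and satisfying the augmentation axiom. -/
def IsMatroid {s : ℕ} (Δ : Finset (Fin s) → Prop) : Prop :=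
  Δ ∅ ∧ (∀ F G : Finset (Fin s), Δ F → G ⊆ F → Δ G) ∧
    (∀ F G : Finset (Fin s), Δ F → Δ G → G.card < F.card →
      ∃ j ∈ F, j ∉ G ∧ Δ (insert j G))

/-- `F` is a basis (facet) of the simplicial complex `Δ`: a maximal face. -/
def IsBasisOf {s : ℕ} (Δ : Finset (Fin s) → Prop) (F : Finset (Fin s)) : Prop :=
  Δ F ∧ ∀ G : Finset (Fin s), Δ G → F ⊆ G → G = F

/-- The Stanley–Reisner ideal of `Δ`, generated by the squarefree monomials corresponding
to the non-faces of `Δ`. -/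
def stanleyReisnerIdeal (k : Type) [Field k] {s : ℕ} (Δ : Finset (Fin s) → Prop) :
    Ideal (MvPolynomial (Fin s) k) :=
  Ideal.span
    ((fun F : Finset (Fin s) => ∏ i ∈ F, (X i : MvPolynomial (Fin s) k)) '' {F | ¬ Δ F})

/-- The ideal `I_{W_c}`: the intersection of all ideals `(A_{i_1,j_1}, …, A_{i_c,j_c})`
where `i_1 < ⋯ < i_c` and each generator is chosen from a different group. -/
def multiPartiteIdeal {A : Type*} [CommRing A] {s : ℕ} (c : ℕ) {e : Fin s → ℕ}
    (g : (i : Fin s) → Fin (e i) → A) : Ideal A :=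
  ⨅ T ∈ {T : Finset (Fin s) | T.card = c}, ⨅ j : (i : Fin s) → Fin (e i),
    Ideal.span ((fun i => g i (j i)) '' ↑T)

end

/-- The element `t` is a nonzerodivisor modulo the ideal `I`. -/
def RegularModulo {A : Type*} [CommRing A] (I : Ideal A) (t : A) : Prop :=
  ∀ g, t * g ∈ I → g ∈ I

/-- Every element of the family `f` indexed by `E` is a nonzerodivisor modulo `I` together with
at most `c` other members of the family. -/
def RegularFamily {A ι : Type*} [CommRing A] (f : ι → A) (I : Ideal A) (E : Finset ι) (c : ℕ) :
    Prop :=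
  ∀ T ⊆ E, T.card ≤ c → ∀ i ∈ E, i ∉ T → RegularModulo (I ⊔ Ideal.span (f '' ↑T)) (f i)

section RegularFamily

variable {A ι : Type*} [CommRing A] {f : ι → A}

theorem mem_sup_of_le {I I' K K' : Ideal A} (hI : I ≤ I') (hK : K ≤ K') {x : A}
    (hx : x ∈ I ⊔ K) : x ∈ I' ⊔ K' :=
  sup_le_sup hI hK hx

theorem RegularFamily.mono {I : Ideal A} {E E' : Finset ι} {c c' : ℕ}
    (h : RegularFamily f I E c) (hE : E' ⊆ E) (hc : c' ≤ c) : RegularFamily f I E' c' :=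
  fun T hT hTc i hi hiT => h T (hT.trans hE) (hTc.trans hc) i (hE hi) hiT

variable [DecidableEq ι]

theorem span_image_insert (f : ι → A) (x : ι) (T : Finset ι) :
    Ideal.span (f '' ↑(insert x T)) = Ideal.span {f x} ⊔ Ideal.span (f '' ↑T) := by
  rw [Finset.coe_insert, Set.image_insert_eq, Ideal.span_insert]

theorem RegularFamily.sup_span_singleton {I : Ideal A} {E E' : Finset ι} {c : ℕ} {x : ι}
    (h : RegularFamily f I E (c + 1)) (hE : E' ⊆ E) (hx : x ∈ E) (hxE : x ∉ E') :
    RegularFamily f (I ⊔ Ideal.span {f x}) E' c := by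
  intro T hT hTc i hi hiT
  have := h (insert x T) (Finset.insert_subset hx (hT.trans hE))
    ((Finset.card_insert_le _ _).trans (by lia)) i (hE hi)
    (by
      rw [Finset.mem_insert, not_or]
      exact ⟨fun e => hxE (e ▸ hi), hiT⟩)
  rwa [span_image_insert, ← sup_assoc] at this

theorem RegularFamily.regularModulo_sup_span {I : Ideal A} {B : Finset ι} {x : ι} {c : ℕ}
    (h : RegularFamily f I (insert x B) c) (hx : x ∉ B) (hc : B.card ≤ c) :
    RegularModulo (I ⊔ Ideal.span (f '' ↑B)) (f x) :=
  h B (Finset.subset_insert _ _) hc x (Finset.mem_insert_self _ _) hx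

theorem sup_span_singleton_pow_succ_le (Q : Ideal A) (x : A) (e : ℕ) :
    (Ideal.span {x} ⊔ Q) ^ (e + 1) ≤ Q ^ (e + 1) ⊔ Ideal.span {x} * (Ideal.span {x} ⊔ Q) ^ e := by
  induction e with
  | zero => simp [sup_comm]
  | succ e ih =>
    rw [pow_succ (Ideal.span {x} ⊔ Q) (e + 1), mul_comm, Ideal.sup_mul]
    refine sup_le le_sup_right ((Ideal.mul_mono_right ih).trans ?_)
    rw [Ideal.mul_sup, ← pow_succ', ← mul_assoc, mul_comm Q, mul_assoc]
    refine sup_le_sup le_rfl (Ideal.mul_mono_right ?_)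
    rw [pow_succ']
    exact Ideal.mul_mono_left le_sup_right

theorem sup_span_singleton_pow_le (Q : Ideal A) (x : A) (e : ℕ) :
    (Ideal.span {x} ⊔ Q) ^ e ≤ Ideal.span {x} ⊔ Q ^ e := by
  cases e with
  | zero => simp
  | succ e =>
    refine (sup_span_singleton_pow_succ_le Q x e).trans (sup_le le_sup_right ?_)
    exact le_sup_of_le_left Ideal.mul_le_left

/-- If `x` is a nonzerodivisor modulo `I ⊔ Q ^ (e + 1)`, then multiplication by `x` raises the
order along `(x) ⊔ Q` by exactly one. -/
theorem mem_pow_of_mul_mem_pow_succ {I Q : Ideal A} {x h : A} {e : ℕ}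
    (hx : RegularModulo (I ⊔ Q ^ (e + 1)) x)
    (hh : x * h ∈ I ⊔ (Ideal.span {x} ⊔ Q) ^ (e + 1)) :
    h ∈ I ⊔ (Ideal.span {x} ⊔ Q) ^ e := by
  have h1 := mem_sup_of_le le_rfl (sup_span_singleton_pow_succ_le Q x e) hh
  rw [← sup_assoc] at h1
  obtain ⟨p, hp, q, hq, hpq⟩ := Submodule.mem_sup.mp h1
  obtain ⟨z, hz, rfl⟩ := Ideal.mem_span_singleton_mul.mp hq
  have h2 : h - z ∈ I ⊔ Q ^ (e + 1) := hx _ (by rw [mul_sub, ← hpq, add_sub_cancel_right]; exact hp)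
  have h3 : Q ^ (e + 1) ≤ (Ideal.span {x} ⊔ Q) ^ e :=
    (Ideal.pow_le_pow_right e.le_succ).trans (Ideal.pow_right_mono le_sup_right e)
  rw [← sub_add_cancel h z]
  exact add_mem (mem_sup_of_le le_rfl h3 h2) (Ideal.mem_sup_right hz)

/-- A nonzerodivisor modulo an ideal generated by a regular family stays a nonzerodivisor modulo
the powers of this ideal. -/
theorem RegularModulo.pow_span {I : Ideal A} {B : Finset ι} (hB : RegularFamily f I B B.card)
    {t : A} (ht : RegularModulo (I ⊔ Ideal.span (f '' ↑B)) t) (e : ℕ) :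
    RegularModulo (I ⊔ Ideal.span (f '' ↑B) ^ e) t := by
  induction B using Finset.induction_on generalizing I t e with
  | empty =>
    cases e with
    | zero => intro g _; simp
    | succ e => simpa using ht
  | insert x Q hx ih =>
    rw [Finset.card_insert_of_notMem hx] at hB
    have hQ := hB.mono (Finset.subset_insert x Q) Q.card.le_succ
    have hxQ := hB.regularModulo_sup_span hx Q.card.le_succ
    rw [span_image_insert] at ht ⊢
    have key := ih (hB.sup_span_singleton (Finset.subset_insert x Q)
      (Finset.mem_insert_self x Q) hx) (by rwa [sup_assoc])
    have key' := ih hQ hxQ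
    generalize Ideal.span (f '' ↑Q) = P at *
    induction e with
    | zero => intro g _; simp
    | succ e ihe =>
      intro g hg
      have h1 : g ∈ I ⊔ Ideal.span {f x} ⊔ P ^ (e + 1) := by
        refine key (e + 1) g ?_
        rw [sup_assoc]
        exact mem_sup_of_le le_rfl (sup_span_singleton_pow_le P (f x) (e + 1)) hg
      rw [sup_right_comm] at h1
      obtain ⟨p, hp, q, hq, rfl⟩ := Submodule.mem_sup.mp h1
      obtain ⟨h, rfl⟩ := Ideal.mem_span_singleton'.mp hq
      have hp' : p ∈ I ⊔ (Ideal.span {f x} ⊔ P) ^ (e + 1) :=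
        mem_sup_of_le le_rfl (Ideal.pow_right_mono le_sup_right _) hp
      refine add_mem hp' ?_
      have h2 : f x * (t * h) ∈ I ⊔ (Ideal.span {f x} ⊔ P) ^ (e + 1) := by
        have := sub_mem hg (Ideal.mul_mem_left _ t hp')
        rwa [mul_add, add_sub_cancel_left, show t * (h * f x) = f x * (t * h) by ring] at this
      have h3 := ihe _ (mem_pow_of_mul_mem_pow_succ (key' (e + 1)) h2)
      obtain ⟨a, ha, b, hb, rfl⟩ := Submodule.mem_sup.mp h3
      rw [add_mul]
      refine add_mem (Ideal.mem_sup_left (Ideal.mul_mem_right _ _ ha)) (Ideal.mem_sup_right ?_)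
      rw [pow_succ]
      exact Ideal.mul_mem_mul hb (Ideal.mem_sup_left (Ideal.mem_span_singleton_self _))

/-- A nonzerodivisor modulo an ideal generated by a regular family stays a nonzerodivisor modulo
the ideal generated by powers of the members of the family. -/
theorem RegularModulo.span_pow {I : Ideal A} {B : Finset ι} (hB : RegularFamily f I B B.card)
    {t : A} (ht : RegularModulo (I ⊔ Ideal.span (f '' ↑B)) t) (e : ι → ℕ) :
    RegularModulo (I ⊔ Ideal.span ((fun i => f i ^ e i) '' ↑B)) t := by
  induction B using Finset.induction_on generalizing I t with
  | empty => simpa using ht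
  | insert x Q hx ih =>
    rw [Finset.card_insert_of_notMem hx] at hB
    have hQ := hB.mono (Finset.subset_insert x Q) Q.card.le_succ
    have hxQ := hB.regularModulo_sup_span hx Q.card.le_succ
    rw [span_image_insert] at ht ⊢
    have key := ih (hB.sup_span_singleton (Finset.subset_insert x Q)
      (Finset.mem_insert_self x Q) hx) (by rwa [sup_assoc])
    set K := Ideal.span ((fun i => f i ^ e i) '' ↑Q)
    generalize e x = n
    induction n with
    | zero => intro g _; simp
    | succ n ihn =>
      intro g hg
      have h1 : g ∈ I ⊔ Ideal.span {f x} ⊔ K := by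
        refine key g ((?_ : I ⊔ (Ideal.span {f x ^ (n + 1)} ⊔ K) ≤ _) hg)
        rw [← sup_assoc]
        refine sup_le_sup (sup_le_sup le_rfl ?_) le_rfl
        rw [Ideal.span_singleton_le_span_singleton]
        exact dvd_pow_self _ n.succ_ne_zero
      rw [sup_right_comm] at h1
      obtain ⟨p, hp, q, hq, rfl⟩ := Submodule.mem_sup.mp h1
      obtain ⟨h, rfl⟩ := Ideal.mem_span_singleton'.mp hq
      have hp' : p ∈ I ⊔ (Ideal.span {f x ^ (n + 1)} ⊔ K) := mem_sup_of_le le_rfl le_sup_right hp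
      refine add_mem hp' ?_
      have h2 : t * (h * f x) ∈ I ⊔ K ⊔ Ideal.span {f x ^ (n + 1)} := by
        rw [sup_right_comm, sup_assoc]
        have := sub_mem hg (Ideal.mul_mem_left _ t hp')
        rwa [mul_add, add_sub_cancel_left] at this
      obtain ⟨a, ha, b, hb, hab⟩ := Submodule.mem_sup.mp h2
      obtain ⟨z, rfl⟩ := Ideal.mem_span_singleton'.mp hb
      have h3 : t * h - z * f x ^ n ∈ I ⊔ K := by
        refine ih hQ hxQ _ ?_
        rwa [show f x * (t * h - z * f x ^ n) = a by linear_combination -hab]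
      have h4 : h ∈ I ⊔ (Ideal.span {f x ^ n} ⊔ K) := by
        refine ihn h ?_
        rw [← sub_add_cancel (t * h) (z * f x ^ n)]
        exact add_mem (mem_sup_of_le le_rfl le_sup_right h3) (Ideal.mem_sup_right
          (Ideal.mem_sup_left (Ideal.mul_mem_left _ _ (Ideal.mem_span_singleton_self _))))
      rw [sup_left_comm] at h4 ⊢
      obtain ⟨a, ha, b, hb, rfl⟩ := Submodule.mem_sup.mp h4
      obtain ⟨y, rfl⟩ := Ideal.mem_span_singleton'.mp ha
      rw [add_mul]
      refine add_mem (Ideal.mem_sup_left ?_) (Ideal.mem_sup_right (Ideal.mul_mem_right _ _ hb))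
      rw [mul_assoc, ← pow_succ]
      exact Ideal.mul_mem_left _ _ (Ideal.mem_span_singleton_self _)

/-- The monomial `∏ f i ^ a i` in a regular family generating a proper ideal does not lie in the
ideal generated by the powers `f i ^ (a i + 1)`. -/
theorem RegularFamily.sup_span_eq_top_of_prod_pow_mem {I : Ideal A} {B : Finset ι}
    (hB : RegularFamily f I B B.card) (a : ι → ℕ)
    (h : ∏ i ∈ B, f i ^ a i ∈ I ⊔ Ideal.span ((fun i => f i ^ (a i + 1)) '' ↑B)) :
    I ⊔ Ideal.span (f '' ↑B) = ⊤ := by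
  induction B using Finset.induction_on generalizing I with
  | empty => simpa [Ideal.eq_top_iff_one] using h
  | insert x Q hx ih =>
    rw [Finset.card_insert_of_notMem hx] at hB
    have hQ := hB.mono (Finset.subset_insert x Q) Q.card.le_succ
    have hxQ := (hB.regularModulo_sup_span hx Q.card.le_succ).span_pow hQ (fun i => a i + 1)
    rw [span_image_insert, Finset.prod_insert hx] at *
    set K := Ideal.span ((fun i => f i ^ (a i + 1)) '' ↑Q)
    have hpow : ∀ n, RegularModulo (I ⊔ K) (f x ^ n) := by
      intro n
      induction n with
      | zero => intro g hg; simpa using hg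
      | succ n ihn => exact fun g hg => hxQ g (ihn _ (by rwa [← mul_assoc, ← pow_succ]))
    rw [sup_left_comm] at h
    obtain ⟨p, hp, q, hq, hpq⟩ := Submodule.mem_sup.mp h
    obtain ⟨z, rfl⟩ := Ideal.mem_span_singleton'.mp hp
    have h1 : ∏ i ∈ Q, f i ^ a i - z * f x ∈ I ⊔ K := by
      refine hpow (a x) _ ?_
      rwa [show f x ^ a x * (∏ i ∈ Q, f i ^ a i - z * f x) = q by
        linear_combination -hpq]
    rw [← sup_assoc]
    refine ih (hB.sup_span_singleton (Finset.subset_insert x Q)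
      (Finset.mem_insert_self x Q) hx) ?_
    rw [← sub_add_cancel (∏ i ∈ Q, f i ^ a i) (z * f x)]
    exact add_mem (mem_sup_of_le le_sup_left le_rfl h1) (Ideal.mem_sup_left
      (Ideal.mem_sup_right (Ideal.mul_mem_left _ _ (Ideal.mem_span_singleton_self _))))

end RegularFamily

section MatroidIntersection

variable {A ι : Type*} [CommRing A] [DecidableEq ι]

theorem prod_pow_mem_span_pow [Fintype ι] (f : ι → A) (B : Finset ι) (a : ι → ℕ) {e : ℕ}
    (he : e ≤ ∑ i ∈ B, a i) : ∏ i, f i ^ a i ∈ Ideal.span (f '' ↑B) ^ e := by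
  refine Ideal.pow_le_pow_right he ?_
  rw [← Finset.prod_mul_prod_compl B, ← Finset.prod_pow_eq_pow_sum]
  exact Ideal.mul_mem_right _ _ (Ideal.prod_mem_prod fun i hi =>
    Ideal.pow_mem_pow (Ideal.subset_span (Set.mem_image_of_mem f hi)) _)

/-- The ideal generated by the monomials `∏ f i ^ a i` such that `a + w` has weight at least `m`
on every member of `𝓑`. -/
def weightIdeal [Fintype ι] (f : ι → A) (𝓑 : Set (Finset ι)) (w : ι → ℕ) (m : ℕ) : Ideal A :=
  Ideal.span {g | ∃ a : ι → ℕ, (∀ B ∈ 𝓑, m ≤ ∑ i ∈ B, a i + ∑ i ∈ B, w i) ∧ g = ∏ i, f i ^ a i}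

/-- Let `𝓑` be the set of bases of a matroid of rank `c`, and suppose that modulo `I` any `c + 1`
members of the family `f` form a regular sequence. Then the intersection over `B ∈ 𝓑` of the
powers of the ideals `(f i : i ∈ B)` of exponent `m - w(B)` is generated modulo `I` by monomials
in the family. -/
theorem iInf_pow_le_weightIdeal [Fintype ι] {f : ι → A} {c : ℕ} {I : Ideal A} {E : Finset ι}
    (hf : RegularFamily f I E c) {𝓑 : Set (Finset ι)} (hE : ∀ B ∈ 𝓑, B ⊆ E)
    (hc : ∀ B ∈ 𝓑, B.card = c)
    (hex : ∀ B₁ ∈ 𝓑, ∀ B₂ ∈ 𝓑, ∀ x ∈ B₁, x ∉ B₂ → ∃ y ∈ B₂, y ∉ B₁ ∧ insert x (B₂.erase y) ∈ 𝓑)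
    (w : ι → ℕ) (m : ℕ) :
    ⨅ B ∈ 𝓑, (I ⊔ Ideal.span (f '' ↑B) ^ (m - ∑ i ∈ B, w i)) ≤ I ⊔ weightIdeal f 𝓑 w m := by
  induction c generalizing I E 𝓑 w m with
  | zero =>
    by_cases hm : ∃ B ∈ 𝓑, 0 < m
    · obtain ⟨B, hB, hm⟩ := hm
      refine (iInf₂_le B hB).trans ?_
      have : Ideal.span (f '' ↑(∅ : Finset ι)) ^ m ≤ ⊥ :=
        (Ideal.pow_le_self hm.ne').trans (by simp)
      rw [Finset.card_eq_zero.mp (hc B hB), Finset.sum_empty, Nat.sub_zero]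
      exact sup_le_sup le_rfl (this.trans bot_le)
    · push Not at hm
      refine le_top.trans (le_trans (le_of_eq ?_) le_sup_right)
      rw [eq_comm, Ideal.eq_top_iff_one]
      exact Ideal.subset_span ⟨0, fun B hB => by have := hm B hB; lia, by simp⟩
  | succ c ih =>
    induction hN : ∑ i, (m - w i) using Nat.strong_induction_on generalizing w with
    | _ N ihN =>
    by_cases htriv : ∀ B ∈ 𝓑, m ≤ ∑ i ∈ B, w i
    · refine le_top.trans (le_trans (le_of_eq ?_) le_sup_right)
      rw [eq_comm, Ideal.eq_top_iff_one]
      exact Ideal.subset_span ⟨0, fun B hB => by simpa using htriv B hB, by simp⟩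
    push Not at htriv
    obtain ⟨B₀, hB₀, hwB₀⟩ := htriv
    obtain ⟨i₀, hi₀⟩ := Finset.card_pos.mp (by rw [hc B₀ hB₀]; exact c.succ_pos)
    classical
    obtain ⟨i, hi, himin⟩ := Finset.exists_min_image
      (Finset.univ.filter fun i => ∃ B ∈ 𝓑, i ∈ B) w ⟨i₀, by simpa using ⟨B₀, hB₀, hi₀⟩⟩
    simp only [Finset.mem_filter, Finset.mem_univ, true_and] at hi himin
    obtain ⟨B₁, hB₁, hiB₁⟩ := hi
    have hwi : w i < m := by
      refine (himin i₀ ⟨B₀, hB₀, hi₀⟩).trans_lt (lt_of_le_of_lt ?_ hwB₀)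
      exact Finset.single_le_sum (f := w) (fun _ _ => Nat.zero_le _) hi₀
    have hiE := hE B₁ hB₁ hiB₁
    set 𝓒 : Set (Finset ι) := {C | i ∉ C ∧ insert i C ∈ 𝓑}
    have hC := ih (hf.sup_span_singleton (E.erase_subset i) hiE (E.notMem_erase i)) (𝓑 := 𝓒)
      (fun C hC j hj => Finset.mem_erase.mpr
        ⟨fun e => hC.1 (e ▸ hj), hE _ hC.2 (Finset.mem_insert_of_mem hj)⟩)
      (fun C hC => by
        have := hc _ hC.2
        rw [Finset.card_insert_of_notMem hC.1] at this
        lia)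
      (by
        rintro C₁ ⟨hi₁, hC₁⟩ C₂ ⟨hi₂, hC₂⟩ x hx₁ hx₂
        have hxi : x ≠ i := fun e => hi₁ (e ▸ hx₁)
        obtain ⟨y, hy₂, hy₁, hy⟩ := hex _ hC₁ _ hC₂ x (Finset.mem_insert_of_mem hx₁)
          (by simp [hxi, hx₂])
        rw [Finset.mem_insert, not_or] at hy₁
        refine ⟨y, Finset.mem_of_mem_insert_of_ne hy₂ hy₁.1, hy₁.2, ?_, ?_⟩
        · simp [hxi.symm, hi₂]
        · rwa [Finset.insert_comm, ← Finset.erase_insert_of_ne (Ne.symm hy₁.1)])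
      w (m - w i)
    have hmono : weightIdeal f 𝓒 w (m - w i) ≤ weightIdeal f 𝓑 w m := by
      refine Ideal.span_mono ?_
      rintro _ ⟨a, ha, rfl⟩
      refine ⟨a, fun B hB => ?_, rfl⟩
      by_cases hiB : i ∈ B
      · have := ha (B.erase i) ⟨B.notMem_erase i, by rwa [Finset.insert_erase hiB]⟩
        have h1 := Finset.add_sum_erase B a hiB
        have h2 := Finset.add_sum_erase B w hiB
        lia
      · obtain ⟨y, hy, -, hy'⟩ := hex B₁ hB₁ B hB i hiB₁ hiB
        have := ha (B.erase y) ⟨fun h => hiB (Finset.mem_of_mem_erase h), hy'⟩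
        have h1 := Finset.add_sum_erase B a hy
        have h2 := Finset.add_sum_erase B w hy
        have h3 := himin y ⟨B, hB, hy⟩
        lia
    intro g hg
    have hgC : g ∈ I ⊔ Ideal.span {f i} ⊔ weightIdeal f 𝓒 w (m - w i) := by
      refine hC ?_
      simp only [Submodule.mem_iInf] at hg ⊢
      rintro C ⟨hiC, hCB⟩
      have h1 := hg _ hCB
      rw [Finset.sum_insert hiC, ← Nat.sub_sub, span_image_insert] at h1
      rw [sup_assoc]
      exact mem_sup_of_le le_rfl (sup_span_singleton_pow_le _ _ _) h1
    rw [sup_right_comm] at hgC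
    obtain ⟨p, hp, q, hq, rfl⟩ := Submodule.mem_sup.mp hgC
    obtain ⟨h, rfl⟩ := Ideal.mem_span_singleton'.mp hq
    have hp' := mem_sup_of_le le_rfl hmono hp
    refine add_mem hp' ?_
    have hK : ∀ B ∈ 𝓑, weightIdeal f 𝓑 w m ≤ Ideal.span (f '' ↑B) ^ (m - ∑ i ∈ B, w i) := by
      intro B hB
      refine Ideal.span_le.mpr ?_
      rintro _ ⟨a, ha, rfl⟩
      exact prod_pow_mem_span_pow f B a (by have := ha B hB; lia)
    set w' : ι → ℕ := w + Pi.single i 1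
    have hw'B : ∀ B : Finset ι, ∑ j ∈ B, w' j = ∑ j ∈ B, w j + if i ∈ B then 1 else 0 := by
      intro B
      simp [w', Finset.sum_add_distrib]
    have hh : h ∈ I ⊔ weightIdeal f 𝓑 w' m := by
      refine ihN (∑ j, (m - w' j)) ?_ w' rfl ?_
      · rw [← hN]
        refine Finset.sum_lt_sum (fun j _ => ?_) ⟨i, Finset.mem_univ i, ?_⟩
        · simp only [w', Pi.add_apply]; lia
        · simp only [w', Pi.add_apply, Pi.single_eq_same]; lia
      · simp only [Submodule.mem_iInf] at hg ⊢
        intro B hB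
        have h1 : f i * h ∈ I ⊔ Ideal.span (f '' ↑B) ^ (m - ∑ i ∈ B, w i) := by
          have := sub_mem (hg B hB) (mem_sup_of_le le_rfl (hK B hB) hp')
          rwa [add_sub_cancel_left, mul_comm] at this
        rw [hw'B]
        by_cases hiB : i ∈ B
        · rw [if_pos hiB, ← Nat.sub_sub]
          revert h1
          cases m - ∑ i ∈ B, w i with
          | zero => simp
          | succ e =>
            intro h1
            have hBi : insert i (B.erase i) = B := Finset.insert_erase hiB
            have hcard : (B.erase i).card = c := by
              rw [Finset.card_erase_of_mem hiB, hc B hB, Nat.add_sub_cancel]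
            have hEB := (B.erase_subset i).trans (hE B hB)
            rw [← hBi, span_image_insert] at h1 ⊢
            refine mem_pow_of_mul_mem_pow_succ ?_ h1
            refine RegularModulo.pow_span (hf.mono hEB (by lia)) ?_ _
            exact hf _ hEB (by lia) i hiE (B.notMem_erase i)
        · rw [if_neg hiB, add_zero]
          refine RegularModulo.pow_span (hf.mono (hE B hB) (hc B hB).le) ?_ _ h h1
          exact hf B (hE B hB) (hc B hB).le i hiE hiB
    obtain ⟨a, ha, b, hb, rfl⟩ := Submodule.mem_sup.mp hh
    rw [add_mul]
    refine add_mem (Ideal.mem_sup_left (Ideal.mul_mem_right _ _ ha)) (Ideal.mem_sup_right ?_)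
    have hle : weightIdeal f 𝓑 w' m * Ideal.span {f i} ≤ weightIdeal f 𝓑 w m := by
      rw [weightIdeal, Ideal.span_mul_span', Ideal.span_le]
      rintro _ ⟨_, ⟨a, ha, rfl⟩, _, rfl, rfl⟩
      refine Ideal.subset_span ⟨a + Pi.single i 1, fun B hB => ?_, ?_⟩
      · have h1 := ha B hB
        have h2 : ∑ j ∈ B, (a + Pi.single i 1 : ι → ℕ) j = ∑ j ∈ B, a j + if i ∈ B then 1 else 0 := by
          simp [Finset.sum_add_distrib]
        rw [hw'B] at h1
        lia
      · simp only [Pi.add_apply, pow_add, Finset.prod_mul_distrib]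
        simp [Pi.single_apply, pow_ite]
    exact hle (Ideal.mul_mem_mul hb (Ideal.mem_span_singleton_self _))

end MatroidIntersection

section SymbolicPower

variable {A : Type*} [CommRing A]

theorem mem_symbolicPower_iff {J : Ideal A} {m : ℕ} {g : A} :
    g ∈ symbolicPower J m ↔
      ∀ Q : Ideal A, IsAssociatedPrime Q (A ⧸ J) → ∃ t ∉ Q, t * g ∈ J ^ m := by
  simp only [symbolicPower, Submodule.mem_sInf]
  constructor
  · intro h Q hQ
    have := h _ ⟨Q, hQ, rfl⟩
    rwa [Ideal.mem_comap, IsLocalization.algebraMap_mem_map_algebraMap_iff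
      (@Ideal.primeCompl A _ Q hQ.1)] at this
  · rintro h _ ⟨Q, hQ, rfl⟩
    rw [Ideal.mem_comap, IsLocalization.algebraMap_mem_map_algebraMap_iff
      (@Ideal.primeCompl A _ Q hQ.1)]
    exact h Q hQ

theorem isAssociatedPrime_quotient_iff [IsNoetherianRing A] {J Q : Ideal A} :
    IsAssociatedPrime Q (A ⧸ J) ↔ Q.IsPrime ∧ ∃ x, ∀ y, y ∈ Q ↔ y * x ∈ J := by
  have key : ∀ x y : A, y ∈ (⊥ : Submodule A (A ⧸ J)).colon {Ideal.Quotient.mk J x} ↔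
      y * x ∈ J := by
    intro x y
    rw [Submodule.mem_colon_singleton, Submodule.mem_bot, Algebra.smul_def,
      Ideal.Quotient.algebraMap_eq, ← map_mul, Ideal.Quotient.eq_zero_iff_mem]
  rw [isAssociatedPrime_iff]
  refine and_congr_right fun _ => ⟨?_, ?_⟩
  · rintro ⟨x, hx⟩
    obtain ⟨x, rfl⟩ := Ideal.Quotient.mk_surjective x
    exact ⟨x, fun y => by rw [hx, key]⟩
  · rintro ⟨x, hx⟩
    exact ⟨Ideal.Quotient.mk J x, Ideal.ext fun y => by rw [hx, key]⟩

theorem exists_regularModulo_mem [IsNoetherianRing A] {P K : Ideal A}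
    (h : ∀ Q : Ideal A, IsAssociatedPrime Q (A ⧸ P) → ∃ t ∈ K, t ∉ Q) :
    ∃ t ∈ K, RegularModulo P t := by
  by_contra! hK
  have hfin := associatedPrimes.finite A (A ⧸ P)
  have hsub : (K : Set A) ⊆ ⋃ Q ∈ (hfin.toFinset : Set (Ideal A)), (Q : Set A) := by
    intro t ht
    have h1 := hK t ht
    simp only [RegularModulo, not_forall] at h1
    obtain ⟨g, hg, hgP⟩ := h1
    rw [Set.Finite.coe_toFinset, biUnion_associatedPrimes_eq_zero_divisors]
    refine ⟨Ideal.Quotient.mk P g, by rwa [Ne, Ideal.Quotient.eq_zero_iff_mem], ?_⟩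
    rwa [Algebra.smul_def, Ideal.Quotient.algebraMap_eq, ← map_mul,
      Ideal.Quotient.eq_zero_iff_mem]
  obtain ⟨Q, hQ, hKQ⟩ := (Ideal.subset_union_prime ⊥ ⊥
    (fun Q hQ _ _ => (hfin.mem_toFinset.mp hQ).isPrime)).mp hsub
  obtain ⟨t, ht, htQ⟩ := h Q (hfin.mem_toFinset.mp hQ)
  exact htQ (hKQ ht)

/-- If `J ⊆ P` agree up to a nonzerodivisor `u` modulo `P`, and nonzerodivisors modulo `P` remain
so modulo `P ^ m`, then the `m`-th symbolic power of `J` lies in `P ^ m`. -/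
theorem symbolicPower_le_pow [IsNoetherianRing A] {J P : Ideal A} (hJP : J ≤ P) {u : A}
    (hu : RegularModulo P u) (huJ : ∀ g ∈ P, u * g ∈ J) {m : ℕ}
    (hpow : ∀ t, RegularModulo P t → RegularModulo (P ^ m) t) :
    symbolicPower J m ≤ P ^ m := by
  intro g hg
  rw [mem_symbolicPower_iff] at hg
  obtain ⟨t, ht, htP⟩ := exists_regularModulo_mem (P := P) (K := (P ^ m).colon {g}) (by
    intro Q hQ
    obtain ⟨hQp, x, hx⟩ := isAssociatedPrime_quotient_iff.mp hQ
    obtain ⟨t, htQ, ht⟩ := hg Q (isAssociatedPrime_quotient_iff.mpr ⟨hQp, u * x, fun y => by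
      rw [hx, mul_left_comm]
      exact ⟨huJ _, fun h => hu _ (hJP h)⟩⟩)
    exact ⟨t, Submodule.mem_colon_singleton.mpr (Ideal.pow_right_mono hJP m ht), htQ⟩)
  exact hpow t htP g (Submodule.mem_colon_singleton.mp ht)

/-- If `J` contains a finite intersection of ideals `P` that contain it and agree with it up to
nonzerodivisors modulo `P`, then its `m`-th symbolic power contains the intersection of the
`P ^ m`. -/
theorem iInf_pow_le_symbolicPower [IsNoetherianRing A] {κ : Type*} {𝓑 : Finset κ} {J : Ideal A}
    {P : κ → Ideal A} (hJP : ∀ B ∈ 𝓑, J ≤ P B) (hJ : ⨅ B ∈ 𝓑, P B ≤ J)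
    (hu : ∀ B ∈ 𝓑, ∃ u, RegularModulo (P B) u ∧ ∀ g ∈ P B, u * g ∈ J) (m : ℕ) :
    ⨅ B ∈ 𝓑, P B ^ m ≤ symbolicPower J m := by
  intro g hg
  rw [mem_symbolicPower_iff]
  intro Q hQ
  obtain ⟨hQp, x, hx⟩ := isAssociatedPrime_quotient_iff.mp hQ
  obtain ⟨B, hB, hBQ⟩ := (Ideal.IsPrime.inf_le' (f := fun B => (P B).colon {x}) hQp
    (s := 𝓑)).mp (by
      intro y hy
      rw [hx]
      refine hJ ?_
      simp only [Finset.inf_eq_iInf, Submodule.mem_iInf] at hy ⊢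
      exact fun B hB => Submodule.mem_colon_singleton.mp (hy B hB))
  obtain ⟨u, hu, huJ⟩ := hu B hB
  have huQ : u ∉ Q := by
    intro h
    have h1 := hu x (hJP B hB ((hx u).mp h))
    exact hQp.ne_top ((Ideal.eq_top_iff_one Q).mpr
      (hBQ (Submodule.mem_colon_singleton.mpr (by simpa using h1))))
  refine ⟨u ^ m, fun h => huQ (hQp.mem_of_pow_mem m h), ?_⟩
  have h1 : Ideal.span {u} * P B ≤ J := by
    rw [Ideal.span_singleton_mul_le_iff]
    exact huJ
  refine Ideal.pow_right_mono h1 m ?_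
  rw [mul_pow]
  simp only [Submodule.mem_iInf] at hg
  exact Ideal.mul_mem_mul (Ideal.pow_mem_pow (Ideal.mem_span_singleton_self u) m) (hg B hB)

end SymbolicPower

section RegularSequence

open RingTheory.Sequence

variable {A ι : Type*} [CommRing A]

theorem regularFamily_of_isWeaklyRegular {f : ι → A} {c : ℕ}
    (h : ∀ l : List ι, l.Nodup → l.length ≤ c + 1 → IsWeaklyRegular A (l.map f)) (E : Finset ι) :
    RegularFamily f ⊥ E c := by
  intro T _ hTc i _ hiT g hg
  have h1 := h (T.toList ++ [i])
    (List.nodup_append'.mpr ⟨T.nodup_toList, List.nodup_singleton i, by simpa using hiT⟩)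
    (by simpa using hTc)
  rw [List.map_append, isWeaklyRegular_append_iff, List.map_singleton,
    isWeaklyRegular_singleton_iff] at h1
  have h2 : Ideal.ofList (T.toList.map f) = Ideal.span (f '' ↑T) := by
    rw [Ideal.ofList]
    congr 1
    ext
    simp
  have h3 := (isSMulRegular_quotient_iff_mem_of_smul_mem _ _).mp h1.2 g
  rw [h2, smul_eq_mul, Ideal.mul_top, smul_eq_mul] at h3
  rw [bot_sup_eq] at hg ⊢
  exact h3 hg

/-- The monomial `∏ f i ^ a i` in a regular sequence does not lie in the ideal generated by the
powers `f i ^ (a i + 1)`. -/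
theorem prod_pow_notMem_span_of_isRegular [IsNoetherianRing A] {s : ℕ} {f : Fin s → A}
    (hf : IsRegular A (List.ofFn f)) (a : Fin s → ℕ) :
    ∏ i, f i ^ a i ∉ Ideal.span (Set.range fun i => f i ^ (a i + 1)) := by
  intro hmem
  have hne : Ideal.span (Set.range f) ≠ ⊤ := by
    intro htop
    refine hf.top_ne_smul ?_
    have : Ideal.ofList (List.ofFn f) = Ideal.span (Set.range f) := by
      rw [Ideal.ofList]
      congr 1
      ext
      simp [List.mem_ofFn]
    rw [this, htop, smul_eq_mul, Ideal.mul_top]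
  obtain ⟨Q, hQ, hfQ⟩ := Ideal.exists_le_maximal _ hne
  have hQp := hQ.isPrime
  let L := Localization.AtPrime Q
  let F : Fin s → L := fun i => algebraMap A L (f i)
  have hFmem : ∀ i, F i ∈ IsLocalRing.maximalIdeal L := fun i =>
    (IsLocalization.AtPrime.to_map_mem_maximal_iff L Q (f i)).mpr
      (hfQ (Ideal.subset_span ⟨i, rfl⟩))
  have hLnoeth : IsNoetherianRing L := IsLocalization.isNoetherianRing Q.primeCompl L inferInstance
  have hFreg : IsWeaklyRegular L ((List.finRange s).map F) := by
    have := hf.toIsWeaklyRegular.of_isLocalization L Q.primeCompl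
    rwa [List.ofFn_eq_map, List.map_map] at this
  have hfam : RegularFamily F ⊥ Finset.univ s := by
    refine regularFamily_of_isWeaklyRegular (fun l hl _ => ?_) _
    have hperm : (List.finRange s).Perm (l ++ (List.finRange s).filter (· ∉ l)) := by
      refine (List.perm_ext_iff_of_nodup (List.nodup_finRange s) ?_).mpr fun i => ?_
      · exact List.nodup_append'.mpr ⟨hl, (List.nodup_finRange s).filter _, by
          intro i hi hi'
          simp at hi'
          exact hi' hi⟩
      · by_cases hi : i ∈ l <;> simp [hi]
    have := IsLocalRing.isWeaklyRegular_of_perm_of_subset_maximalIdeal hFreg (hperm.map F) (by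
      intro r hr
      obtain ⟨i, -, rfl⟩ := List.mem_map.mp hr
      exact hFmem i)
    rw [List.map_append, isWeaklyRegular_append_iff] at this
    exact this.1
  have htop := RegularFamily.sup_span_eq_top_of_prod_pow_mem (B := Finset.univ)
    (hfam.mono le_rfl (by simp)) a (by
      have := Ideal.mem_map_of_mem (algebraMap A L) hmem
      rw [Ideal.map_span, ← Set.range_comp] at this
      simpa [F, Function.comp_def] using this)
  refine (IsLocalRing.maximalIdeal.isMaximal L).ne_top (top_le_iff.mp (htop ▸ ?_))
  refine sup_le bot_le (Ideal.span_le.mpr ?_)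
  rintro _ ⟨i, -, rfl⟩
  exact hFmem i

theorem regularFamily_X (k σ : Type*) [Field k] (E : Finset σ) (c : ℕ) :
    RegularFamily (X : σ → MvPolynomial σ k) ⊥ E c := by
  intro T _ _ i _ hiT g hg
  rw [bot_sup_eq, mem_ideal_span_X_image] at *
  intro b hb
  obtain ⟨j, hj, hj'⟩ := hg (Finsupp.single i 1 + b) (by
    rw [mem_support_iff] at hb ⊢
    rwa [coeff_X_mul])
  refine ⟨j, hj, ?_⟩
  have hij : i ≠ j := fun e => hiT (e ▸ hj)
  simpa [Finsupp.single_apply, hij] using hj'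

end RegularSequence

section StanleyReisner

/-- The ideal generated by the products of the members of `f` over the non-faces of `Δ`. -/
def nonfaceIdeal {A : Type*} [CommRing A] {s : ℕ} (f : Fin s → A) (Δ : Finset (Fin s) → Prop) :
    Ideal A :=
  Ideal.span ((fun F : Finset (Fin s) => ∏ i ∈ F, f i) '' {F | ¬ Δ F})

/-- The complements of the bases of `Δ`, that is, the bases of the dual matroid. -/
def cobases {s : ℕ} (Δ : Finset (Fin s) → Prop) : Set (Finset (Fin s)) :=
  {B | IsBasisOf Δ Bᶜ}

variable {A : Type*} [CommRing A] {s : ℕ} {Δ : Finset (Fin s) → Prop}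

theorem iInf_isBasisOf_eq_iInf_cobases (P : Finset (Fin s) → Ideal A) :
    ⨅ F ∈ {F : Finset (Fin s) | IsBasisOf Δ F}, P Fᶜ = ⨅ B ∈ cobases Δ, P B := by
  refine le_antisymm (le_iInf₂ fun B hB => ?_) (le_iInf₂ fun F hF => ?_)
  · exact (iInf₂_le Bᶜ hB).trans (by rw [compl_compl])
  · exact iInf₂_le Fᶜ (by simpa [cobases] using hF)

theorem map_aeval_stanleyReisnerIdeal {k : Type} [Field k] [Algebra k A] (f : Fin s → A) :
    Ideal.map (aeval (R := k) f).toRingHom (stanleyReisnerIdeal k Δ) = nonfaceIdeal f Δ := by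
  rw [stanleyReisnerIdeal, Ideal.map_span, Set.image_image, nonfaceIdeal]
  simp

theorem map_aeval_weightIdeal {k : Type} [Field k] [Algebra k A] (f : Fin s → A)
    (𝓑 : Set (Finset (Fin s))) (w : Fin s → ℕ) (m : ℕ) :
    Ideal.map (aeval (R := k) f).toRingHom (weightIdeal X 𝓑 w m) = weightIdeal f 𝓑 w m := by
  rw [weightIdeal, Ideal.map_span, weightIdeal]
  congr 1
  ext g
  constructor
  · rintro ⟨_, ⟨a, ha, rfl⟩, rfl⟩
    exact ⟨a, ha, by simp⟩
  · rintro ⟨a, ha, rfl⟩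
    exact ⟨_, ⟨a, ha, rfl⟩, by simp⟩

theorem weightIdeal_zero_le_pow (f : Fin s → A) {𝓑 : Set (Finset (Fin s))} {B : Finset (Fin s)}
    (hB : B ∈ 𝓑) (m : ℕ) : weightIdeal f 𝓑 0 m ≤ Ideal.span (f '' ↑B) ^ m := by
  refine Ideal.span_le.mpr ?_
  rintro _ ⟨a, ha, rfl⟩
  exact prod_pow_mem_span_pow f B a (by simpa using ha B hB)

theorem nonfaceIdeal_le_span (hΔ : IsMatroid Δ) (f : Fin s → A) {B : Finset (Fin s)}
    (hB : B ∈ cobases Δ) : nonfaceIdeal f Δ ≤ Ideal.span (f '' ↑B) := by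
  refine Ideal.span_le.mpr ?_
  rintro _ ⟨F, hF, rfl⟩
  obtain ⟨i, hi, hiB⟩ : ∃ i ∈ F, i ∈ B := by
    by_contra! h
    exact hF (hΔ.2.1 _ F hB.1 fun i hi => Finset.mem_compl.mpr (h i hi))
  exact Ideal.mem_of_dvd _ (Finset.dvd_prod_of_mem f hi)
    (Ideal.subset_span (Set.mem_image_of_mem f hiB))

theorem prod_compl_mul_mem_nonfaceIdeal (f : Fin s → A) {B : Finset (Fin s)}
    (hB : B ∈ cobases Δ) {g : A} (hg : g ∈ Ideal.span (f '' ↑B)) :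
    (∏ i ∈ Bᶜ, f i) * g ∈ nonfaceIdeal f Δ := by
  refine (Ideal.span_singleton_mul_le_iff (I := Ideal.span (f '' ↑B))).mp ?_ g hg
  rw [Ideal.span_mul_span', Ideal.span_le]
  rintro _ ⟨_, rfl, _, ⟨i, hi, rfl⟩, rfl⟩
  have hiB : i ∉ Bᶜ := by simpa using hi
  refine Ideal.subset_span ⟨insert i Bᶜ, fun h => hiB ?_, ?_⟩
  · rw [← hB.2 _ h (Finset.subset_insert _ _)]
    exact Finset.mem_insert_self _ _
  · simp [Finset.prod_insert hiB, mul_comm]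

theorem exists_isBasisOf_superset {F : Finset (Fin s)} (hF : Δ F) :
    ∃ G, IsBasisOf Δ G ∧ F ⊆ G := by
  obtain ⟨G, hFG, hG⟩ := (Set.toFinite {G | Δ G}).exists_le_maximal hF
  exact ⟨G, ⟨hG.prop, fun H hH hGH => (hG.eq_of_le hH hGH).symm⟩, hFG⟩

theorem weightIdeal_one_le_nonfaceIdeal (f : Fin s → A) :
    weightIdeal f (cobases Δ) 0 1 ≤ nonfaceIdeal f Δ := by
  refine Ideal.span_le.mpr ?_
  rintro _ ⟨a, ha, rfl⟩
  have hsupp : ¬ Δ {i | a i ≠ 0} := by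
    intro h
    obtain ⟨G, hG, hsub⟩ := exists_isBasisOf_superset h
    have h1 := ha Gᶜ (by simpa [cobases] using hG)
    have h2 : ∑ i ∈ Gᶜ, a i = 0 := Finset.sum_eq_zero fun i hi => by
      by_contra h0
      exact Finset.mem_compl.mp hi (hsub (by simpa using h0))
    simp [h2] at h1
  refine Ideal.mem_of_dvd _ ?_ (Ideal.subset_span ⟨_, hsupp, rfl⟩)
  refine (Finset.prod_dvd_prod_of_dvd _ _ fun i hi => ?_).trans
    (Finset.prod_dvd_prod_of_subset _ _ _ (Finset.subset_univ _))
  exact dvd_pow_self _ (by simpa using hi)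

theorem IsMatroid.cobases_exchange (hΔ : IsMatroid Δ) {r : ℕ}
    (hr : ∀ F, IsBasisOf Δ F → F.card = r) :
    ∀ B₁ ∈ cobases Δ, ∀ B₂ ∈ cobases Δ, ∀ x ∈ B₁, x ∉ B₂ →
      ∃ y ∈ B₂, y ∉ B₁ ∧ insert x (B₂.erase y) ∈ cobases Δ := by
  intro B₁ hB₁ B₂ hB₂ x hx₁ hx₂
  have hx : x ∈ B₂ᶜ := Finset.mem_compl.mpr hx₂
  have hcard : (B₂ᶜ.erase x).card + 1 = r := by
    rw [Finset.card_erase_add_one hx, hr _ hB₂]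
  obtain ⟨y, hy₁, hy₂, hy⟩ := hΔ.2.2 B₁ᶜ (B₂ᶜ.erase x) hB₁.1
    (hΔ.2.1 _ _ hB₂.1 (Finset.erase_subset _ _)) (by rw [hr _ hB₁]; lia)
  rw [Finset.mem_compl] at hy₁
  have hyx : y ≠ x := fun e => hy₁ (e ▸ hx₁)
  have hyB₂ : y ∈ B₂ := by
    by_contra h
    exact hy₂ (Finset.mem_erase.mpr ⟨hyx, Finset.mem_compl.mpr h⟩)
  refine ⟨y, hyB₂, hy₁, ?_⟩
  have heq : (insert x (B₂.erase y))ᶜ = insert y (B₂ᶜ.erase x) := by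
    ext z
    simp only [Finset.mem_compl, Finset.mem_insert, Finset.mem_erase]
    grind
  rw [cobases, Set.mem_ofPred_eq, heq]
  obtain ⟨G, hG, hsub⟩ := exists_isBasisOf_superset hy
  have h1 : (insert y (B₂ᶜ.erase x)).card = r := by
    rw [Finset.card_insert_of_notMem hy₂, hcard]
  rwa [Finset.eq_of_subset_of_card_le hsub (by rw [h1, hr G hG])]

theorem exists_stanleyReisnerIdeal_pow_eq_span {k : Type} [Field k] (r : ℕ) :
    ∃ 𝓢 : Set (Fin s → ℕ), stanleyReisnerIdeal k Δ ^ r =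
      Ideal.span ((fun b => ∏ i, (X i : MvPolynomial (Fin s) k) ^ b i) '' 𝓢) := by
  induction r with
  | zero =>
    refine ⟨{0}, ?_⟩
    simp
  | succ r ih =>
    obtain ⟨𝓢, h𝓢⟩ := ih
    refine ⟨Set.image2 (fun b F i => b i + if i ∈ F then 1 else 0) 𝓢 {F | ¬ Δ F}, ?_⟩
    rw [pow_succ, h𝓢, stanleyReisnerIdeal, Ideal.span_mul_span', Set.image_image2, ← Set.image2_mul,
      Set.image2_image_left, Set.image2_image_right]
    congr 1
    refine Set.image2_congr fun b _ F _ => ?_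
    simp only [pow_add, Finset.prod_mul_distrib]
    simp [pow_ite]

/-- A monomial in the variables lies in a power of the Stanley–Reisner ideal as soon as its image
under the substitution of a regular sequence lies in the image of this power. -/
theorem prod_X_pow_mem_of_prod_pow_mem {k : Type} [Field k] [Algebra k A] [IsNoetherianRing A]
    {f : Fin s → A} (hf : RingTheory.Sequence.IsRegular A (List.ofFn f)) {r : ℕ} {a : Fin s → ℕ}
    (h : ∏ i, f i ^ a i ∈ nonfaceIdeal f Δ ^ r) :
    ∏ i, (X i : MvPolynomial (Fin s) k) ^ a i ∈ stanleyReisnerIdeal k Δ ^ r := by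
  obtain ⟨𝓢, h𝓢⟩ := exists_stanleyReisnerIdeal_pow_eq_span (k := k) (Δ := Δ) r
  rw [← map_aeval_stanleyReisnerIdeal (k := k), ← Ideal.map_pow] at h
  rw [h𝓢] at h ⊢
  by_cases hb : ∃ b ∈ 𝓢, b ≤ a
  · obtain ⟨b, hb, hba⟩ := hb
    exact Ideal.mem_of_dvd _ (Finset.prod_dvd_prod_of_dvd _ _ fun i _ => pow_dvd_pow _ (hba i))
      (Ideal.subset_span (Set.mem_image_of_mem _ hb))
  · refine absurd ?_ (prod_pow_notMem_span_of_isRegular hf a)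
    refine (?_ : Ideal.map _ _ ≤ _) h
    rw [Ideal.map_span, Ideal.span_le]
    rintro _ ⟨_, ⟨b, hbS, rfl⟩, rfl⟩
    obtain ⟨i, hi⟩ : ∃ i, a i < b i := by
      by_contra! hle
      exact hb ⟨b, hbS, hle⟩
    have h1 : ∏ i, f i ^ b i ∈ Ideal.span (Set.range fun i => f i ^ (a i + 1)) :=
      Ideal.mem_of_dvd _ ((pow_dvd_pow (f i) (Nat.succ_le_of_lt hi)).trans
        (Finset.dvd_prod_of_mem (fun i => f i ^ b i) (Finset.mem_univ i)))
        (Ideal.subset_span ⟨i, rfl⟩)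
    simpa using h1

end StanleyReisner

theorem statement15 (k : Type) [Field k] [Infinite k] (s c n : ℕ) (hcs : c ≤ s) (hcn : c ≤ n)
    (Δ : Finset (Fin s) → Prop) (hmat : IsMatroid Δ)
    (hdim : ∀ F, IsBasisOf Δ F → F.card = s - c)
    (f : Fin s → MvPolynomial (Fin (n + 1)) k) (d : Fin s → ℕ)
    (hdeg : ∀ i, (f i).IsHomogeneous (d i))
    (hreg : SubsetsRegular f (c + 1))
    (m r : ℕ) (hm : 0 < m) (hr : 0 < r) :
    ((⨅ F ∈ {F : Finset (Fin s) | IsBasisOf Δ F},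
        (Ideal.span ((X : Fin s → MvPolynomial (Fin s) k) '' ↑(Fᶜ))) ^ m)
          ≤ (stanleyReisnerIdeal k Δ) ^ r →
      symbolicPower (Ideal.map (MvPolynomial.aeval (R := k) f).toRingHom
          (stanleyReisnerIdeal k Δ)) m
        ≤ (Ideal.map (MvPolynomial.aeval (R := k) f).toRingHom (stanleyReisnerIdeal k Δ)) ^ r) ∧
    (RingTheory.Sequence.IsRegular (MvPolynomial (Fin (n + 1)) k) (List.ofFn f) →
      ((⨅ F ∈ {F : Finset (Fin s) | IsBasisOf Δ F},
          (Ideal.span ((X : Fin s → MvPolynomial (Fin s) k) '' ↑(Fᶜ))) ^ m)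
            ≤ (stanleyReisnerIdeal k Δ) ^ r ↔
        symbolicPower (Ideal.map (MvPolynomial.aeval (R := k) f).toRingHom
            (stanleyReisnerIdeal k Δ)) m
          ≤ (Ideal.map (MvPolynomial.aeval (R := k) f).toRingHom
              (stanleyReisnerIdeal k Δ)) ^ r)) := by
  have hrank : ∀ B ∈ cobases Δ, B.card = c := fun B hB => by
    have h1 := hdim _ hB
    rw [Finset.card_compl, Fintype.card_fin] at h1
    have h2 := B.card_le_univ
    rw [Fintype.card_fin] at h2
    lia
  have hex := hmat.cobases_exchange hdim
  have hfam : RegularFamily f ⊥ Finset.univ c :=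
    regularFamily_of_isWeaklyRegular (fun l hl hlc => (hreg l hl hlc).toIsWeaklyRegular) _
  have hweight : ∀ e, ⨅ B ∈ cobases Δ, Ideal.span (f '' ↑B) ^ e ≤ weightIdeal f (cobases Δ) 0 e :=
    fun e => by
      simpa using iInf_pow_le_weightIdeal hfam (fun B _ => B.subset_univ) hrank hex 0 e
  have hu : ∀ B ∈ cobases Δ, RegularModulo (Ideal.span (f '' ↑B)) (∏ i ∈ Bᶜ, f i) := by
    intro B hB
    refine Finset.prod_induction f (RegularModulo (Ideal.span (f '' ↑B))) ?_ ?_ ?_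
    · exact fun x y hx hy g hg => hy g (hx _ (by rwa [← mul_assoc]))
    · intro g hg
      simpa using hg
    · intro i hi
      simpa using hfam B B.subset_univ (hrank B hB).le i (Finset.mem_univ i)
        (Finset.mem_compl.mp hi)
  rw [map_aeval_stanleyReisnerIdeal, iInf_isBasisOf_eq_iInf_cobases
    (fun B : Finset (Fin s) => Ideal.span ((X : Fin s → MvPolynomial (Fin s) k) '' ↑B) ^ m)]
  have hforward : ⨅ B ∈ cobases Δ, Ideal.span ((X : Fin s → MvPolynomial (Fin s) k) '' ↑B) ^ m
      ≤ stanleyReisnerIdeal k Δ ^ r → symbolicPower (nonfaceIdeal f Δ) m ≤ nonfaceIdeal f Δ ^ r := by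
    intro h
    refine le_trans (le_iInf₂ fun B hB => ?_) ((hweight m).trans ?_)
    · refine symbolicPower_le_pow (nonfaceIdeal_le_span hmat f hB) (hu B hB)
        (fun g => prod_compl_mul_mem_nonfaceIdeal f hB) fun t ht => ?_
      have := RegularModulo.pow_span (hfam.mono B.subset_univ (hrank B hB).le) (t := t)
        (by rwa [bot_sup_eq]) m
      rwa [bot_sup_eq] at this
    · rw [← map_aeval_weightIdeal (k := k), ← map_aeval_stanleyReisnerIdeal (k := k),
        ← Ideal.map_pow]
      exact Ideal.map_mono ((le_iInf₂ fun B hB => weightIdeal_zero_le_pow X hB m).trans h)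
  refine ⟨hforward, fun hfreg => ⟨hforward, fun h => ?_⟩⟩
  have hX : ⨅ B ∈ cobases Δ, Ideal.span ((X : Fin s → MvPolynomial (Fin s) k) '' ↑B) ^ m ≤
      weightIdeal X (cobases Δ) 0 m := by
    simpa using iInf_pow_le_weightIdeal (regularFamily_X k (Fin s) Finset.univ c)
      (fun B _ => B.subset_univ) hrank hex 0 m
  refine hX.trans (Ideal.span_le.mpr ?_)
  rintro _ ⟨a, ha, rfl⟩
  refine prod_X_pow_mem_of_prod_pow_mem hfreg (h ?_)
  have hsymb := iInf_pow_le_symbolicPower (𝓑 := (Set.toFinite (cobases Δ)).toFinset)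
    (J := nonfaceIdeal f Δ) (P := fun B => Ideal.span (f '' ↑B))
    (fun B hB => nonfaceIdeal_le_span hmat f (by simpa using hB))
    (by simpa using (hweight 1).trans (weightIdeal_one_le_nonfaceIdeal f))
    (fun B hB => ⟨_, hu B (by simpa using hB),
      fun g => prod_compl_mul_mem_nonfaceIdeal f (by simpa using hB)⟩) m
  refine hsymb ?_
  simp only [Submodule.mem_iInf, Set.Finite.mem_toFinset]
  exact fun B hB => weightIdeal_zero_le_pow f hB m (Ideal.subset_span ⟨a, ha, rfl⟩)
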